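/- arXiv:2401.16574 — 2 statements merged into one kernel-verified Lean document; each statement's English description precedes it below -/
import Mathlib

section
/- Under the RA model (W row-stochastic but not necessarily irreducible): if the poset of communication classes has a unique maximal element, then x_t converges almost surely to a consensus vector x_∞ ∈ {𝟘, 𝟙}. In particular, the RA model converges almost surely to consensus in the presence of a stubborn agent, i.e., an agent k with W_{kk} = 1 (so that x_{t,k} is never influenced by any other agent) such that the singleton {k} is the unique maximal communication class. -/
open MeasureTheory ProbabilityTheory Filter

namespace RA

variable {Ω : Type*}

/-- History σ-algebra generated by `x 1, …, x t` and `a 1, …, a (t-1)`. -/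
def hist {N : ℕ} [MeasurableSpace Ω] (x a : ℕ → Ω → Fin N → ℝ) (t : ℕ) :
    MeasurableSpace Ω :=
  (⨆ s ∈ Finset.Icc 1 t, MeasurableSpace.comap (x s) inferInstance) ⊔
  (⨆ s ∈ Finset.Ico 1 t, MeasurableSpace.comap (a s) inferInstance)

/-- The Random Actions (RA) opinion dynamics model. -/
structure IsRAModel {N : ℕ} [MeasurableSpace Ω] (μ : Measure Ω) (α : ℝ)
    (W : Matrix (Fin N) (Fin N) ℝ) (x a : ℕ → Ω → Fin N → ℝ) : Prop where
  isProb : IsProbabilityMeasure μ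
  alpha_mem : α ∈ Set.Ioo (0 : ℝ) 1
  W_nonneg : ∀ i j, 0 ≤ W i j
  W_rowsum : ∀ i, ∑ j, W i j = 1
  x_meas : ∀ t, Measurable (x t)
  a_meas : ∀ t, Measurable (a t)
  x_mem : ∀ t, 1 ≤ t → ∀ ω i, x t ω i ∈ Set.Icc (0 : ℝ) 1
  a_mem : ∀ t, 1 ≤ t → ∀ ω i, a t ω i = 0 ∨ a t ω i = 1
  update : ∀ t, 1 ≤ t → ∀ ω i,
    x (t + 1) ω i = (1 - α) * x t ω i + α * ∑ j, W i j * a t ω j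
  bernoulli : ∀ t, 1 ≤ t → ∀ b : Fin N → Bool, ∀ H : Set Ω,
    MeasurableSet[hist x a t] H →
    (μ (H ∩ {ω | ∀ i, a t ω i = if b i then (1 : ℝ) else 0})).toReal
      = ∫ ω in H, ∏ i, (if b i then x t ω i else 1 - x t ω i) ∂μ

/-- `W` is irreducible: the network is strongly connected. -/
def Irreducible {N : ℕ} (W : Matrix (Fin N) (Fin N) ℝ) : Prop :=
  ∀ i j, ∃ n : ℕ, 0 < (W ^ n) i j

/-- The event that `x t i ∈ [0,δ) ∪ (1-δ,1]`. -/
def cti {N : ℕ} (x : ℕ → Ω → Fin N → ℝ) (δ : ℝ) (t : ℕ) (i : Fin N) : Set Ω :=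
  {ω | x t ω i < δ ∨ 1 - δ < x t ω i}

def ct {N : ℕ} (x : ℕ → Ω → Fin N → ℝ) (δ : ℝ) (t : ℕ) : Set Ω :=
  ⋂ i, cti x δ t i

def c0 {N : ℕ} (x : ℕ → Ω → Fin N → ℝ) (δ : ℝ) (t : ℕ) (i : Fin N) : Set Ω :=
  {ω | x t ω i < δ}

def c1 {N : ℕ} (x : ℕ → Ω → Fin N → ℝ) (δ : ℝ) (t : ℕ) (i : Fin N) : Set Ω :=
  {ω | 1 - δ < x t ω i}

/-- The event that every coordinate of `x t` is within `δ` of `0`. -/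
def corner0 {N : ℕ} (x : ℕ → Ω → Fin N → ℝ) (δ : ℝ) (t : ℕ) : Set Ω :=
  {ω | ∀ i, x t ω i < δ}

/-- The event that every coordinate of `x t` is within `δ` of `1`. -/
def corner1 {N : ℕ} (x : ℕ → Ω → Fin N → ℝ) (δ : ℝ) (t : ℕ) : Set Ω :=
  {ω | ∀ i, 1 - δ < x t ω i}

/-- Agents `i` and `j` communicate. -/
def Communicates {N : ℕ} (W : Matrix (Fin N) (Fin N) ℝ) (i j : Fin N) : Prop :=
  (∃ n : ℕ, 0 < (W ^ n) j i) ∧ (∃ n : ℕ, 0 < (W ^ n) i j)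

/-- `C` is a communication class (strongly connected component). -/
def CommClass {N : ℕ} (W : Matrix (Fin N) (Fin N) ℝ) (C : Set (Fin N)) : Prop :=
  ∃ i, C = {j | Communicates W i j}

/-- `C` is a maximal communication class: no agent outside `C` has a directed
path into `C`. -/
def IsMaximalClass {N : ℕ} (W : Matrix (Fin N) (Fin N) ℝ) (C : Set (Fin N)) : Prop :=
  CommClass W C ∧ ∀ i ∈ C, ∀ j, (∃ n : ℕ, 0 < (W ^ n) i j) → j ∈ C

section ZeroOne

variable {m0 : MeasurableSpace Ω} {μ : Measure Ω}

/-- An event of the limit σ-algebra whose conditional probabilities along a filtration are bounded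
below by a positive constant has probability one. -/
theorem ae_mem_of_forall_le_measureReal_inter [IsProbabilityMeasure μ] (ℱ : Filtration ℕ m0)
    {E : Set Ω} (hE : MeasurableSet[⨆ n, ℱ n] E) {c : ℝ} (hc : 0 < c)
    (h : ∀ n H, MeasurableSet[ℱ n] H → c * μ.real H ≤ μ.real (H ∩ E)) :
    ∀ᵐ ω ∂μ, ω ∈ E := by
  have hE' : MeasurableSet E := iSup_le ℱ.le _ hE
  set g : Ω → ℝ := E.indicator 1 with hg
  have hgi : Integrable g μ := (integrable_const (1 : ℝ)).indicator hE'
  have hlow : ∀ n, ∀ᵐ ω ∂μ, c ≤ (μ[g | ℱ n]) ω := by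
    intro n
    have hle : (fun _ => c) ≤ᵐ[μ.trim (ℱ.le n)] μ[g | ℱ n] := by
      refine ae_le_of_forall_setIntegral_le (integrable_const c)
        (integrable_condExp.trim (ℱ.le n) stronglyMeasurable_condExp) fun H hH _ => ?_
      rw [← setIntegral_trim (ℱ.le n) stronglyMeasurable_condExp hH,
        setIntegral_condExp (ℱ.le n) hgi hH, setIntegral_const, hg,
        setIntegral_indicator hE']
      simp only [Pi.one_apply, setIntegral_const, smul_eq_mul, mul_one]
      rw [measureReal_def, trim_measurableSet_eq (ℱ.le n) hH, ← measureReal_def, mul_comm]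
      exact h n H hH
    exact ae_le_of_ae_le_trim hle
  have hlim := hgi.tendsto_ae_condExp (ℱ := ℱ)
    ((stronglyMeasurable_const (b := (1 : ℝ))).indicator hE)
  filter_upwards [ae_all_iff.2 hlow, hlim] with ω h1 h2
  by_contra hω
  have := ge_of_tendsto' h2 h1
  simp [hg, hω] at this
  linarith

theorem sum_measureReal_inter_preimage_singleton {β : Type*} [Fintype β] [MeasurableSpace β]
    [MeasurableSingletonClass β] [IsFiniteMeasure μ] {f : Ω → β} (hf : Measurable f) (F : Set Ω) :
    ∑ y, μ.real (F ∩ f ⁻¹' {y}) = μ.real F := by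
  have h := sum_measureReal_preimage_singleton (μ := μ.restrict F) (Finset.univ : Finset β)
    (f := f) (fun y _ => hf (measurableSet_singleton y))
  simp only [Finset.coe_univ, Set.preimage_univ, measureReal_restrict_apply_univ] at h
  rw [← h]
  refine Finset.sum_congr rfl fun y _ => ?_
  rw [measureReal_restrict_apply (hf (measurableSet_singleton y)), Set.inter_comm]

end ZeroOne

section History

variable {N : ℕ} {x a : ℕ → Ω → Fin N → ℝ}

theorem hist_le_of_measurable {m₀ m : MeasurableSpace Ω} {t : ℕ}
    (hx : ∀ s, 1 ≤ s → s ≤ t → Measurable[m] (x s))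
    (ha : ∀ s, 1 ≤ s → s < t → Measurable[m] (a s)) : @hist Ω N m₀ x a t ≤ m := by
  refine sup_le (iSup₂_le fun s hs => ?_) (iSup₂_le fun s hs => ?_)
  · rw [Finset.mem_Icc] at hs
    exact measurable_iff_comap_le.1 (hx s hs.1 hs.2)
  · rw [Finset.mem_Ico] at hs
    exact measurable_iff_comap_le.1 (ha s hs.1 hs.2)

variable [MeasurableSpace Ω]

theorem measurable_hist_x {s t : ℕ} (hs : 1 ≤ s) (hst : s ≤ t) : Measurable[hist x a t] (x s) := by
  rw [measurable_iff_comap_le]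
  exact le_sup_of_le_left (le_iSup₂_of_le s (Finset.mem_Icc.2 ⟨hs, hst⟩) le_rfl)

theorem measurable_hist_a {s t : ℕ} (hs : 1 ≤ s) (hst : s < t) : Measurable[hist x a t] (a s) := by
  rw [measurable_iff_comap_le]
  exact le_sup_of_le_right (le_iSup₂_of_le s (Finset.mem_Ico.2 ⟨hs, hst⟩) le_rfl)

theorem hist_mono : Monotone (hist x a) := fun _ _ hst =>
  hist_le_of_measurable (fun _ h1 h2 => measurable_hist_x h1 (h2.trans hst))
    (fun _ h1 h2 => measurable_hist_a h1 (h2.trans_le hst))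

/-- Exchanging the roles of `0` and `1` does not enlarge the history. -/
theorem hist_one_sub_le (t : ℕ) :
    hist (fun s ω i => 1 - x s ω i) (fun s ω i => 1 - a s ω i) t ≤ hist x a t := by
  have hflip : Measurable fun (v : Fin N → ℝ) i => 1 - v i := by fun_prop
  exact hist_le_of_measurable (fun s h1 h2 => hflip.comp (measurable_hist_x h1 h2))
    (fun s h1 h2 => hflip.comp (measurable_hist_a h1 h2))

theorem le_hist_one_sub (t : ℕ) :
    hist x a t ≤ hist (fun s ω i => 1 - x s ω i) (fun s ω i => 1 - a s ω i) t := by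
  have h := hist_one_sub_le (x := fun s ω i => 1 - x s ω i) (a := fun s ω i => 1 - a s ω i) t
  simpa only [sub_sub_cancel] using h

end History

/-- The event that `H` holds and that from time `t₀` on, the actions obey the feedback policy `b`
during `n` steps. -/
def follows {N : ℕ} (x a : ℕ → Ω → Fin N → ℝ) (b : ℕ → (Fin N → ℝ) → Fin N → Bool) (t₀ : ℕ)
    (H : Set Ω) (n : ℕ) : Set Ω :=
  {ω | ω ∈ H ∧ ∀ s < n, ∀ i, a (t₀ + s) ω i = if b s (x (t₀ + s) ω) i then (1 : ℝ) else 0}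

theorem follows_succ {N : ℕ} (x a : ℕ → Ω → Fin N → ℝ)
    (b : ℕ → (Fin N → ℝ) → Fin N → Bool) (t₀ : ℕ) (H : Set Ω) (n : ℕ) :
    follows x a b t₀ H (n + 1) = follows x a b t₀ H n ∩
      {ω | ∀ i, a (t₀ + n) ω i = if b n (x (t₀ + n) ω) i then (1 : ℝ) else 0} := by
  ext ω
  simp only [follows, Set.mem_ofPred_eq, Set.mem_inter_iff, Nat.lt_succ_iff_lt_or_eq, or_imp,
    forall_and, forall_eq, and_assoc]

section Model

variable {N : ℕ} [MeasurableSpace Ω] {μ : Measure Ω} {α : ℝ} {W : Matrix (Fin N) (Fin N) ℝ}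
  {x a : ℕ → Ω → Fin N → ℝ}

theorem IsRAModel.hist_le (hRA : IsRAModel μ α W x a) (t : ℕ) : hist x a t ≤ ‹_› :=
  hist_le_of_measurable (fun s _ _ => hRA.x_meas s) (fun s _ _ => hRA.a_meas s)

/-- The model is symmetric under exchanging `0` and `1`. -/
theorem IsRAModel.one_sub (hRA : IsRAModel μ α W x a) :
    IsRAModel μ α W (fun s ω i => 1 - x s ω i) (fun s ω i => 1 - a s ω i) where
  isProb := hRA.isProb
  alpha_mem := hRA.alpha_mem
  W_nonneg := hRA.W_nonneg
  W_rowsum := hRA.W_rowsum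
  x_meas t := by
    have := hRA.x_meas t
    fun_prop
  a_meas t := by
    have := hRA.a_meas t
    fun_prop
  x_mem t ht ω i := by
    have := hRA.x_mem t ht ω i
    exact ⟨by linarith [this.2], by linarith [this.1]⟩
  a_mem t ht ω i := by
    rcases hRA.a_mem t ht ω i with h | h <;> simp [h]
  update t ht ω i := by
    simp only [hRA.update t ht ω i, mul_sub, mul_one, Finset.sum_sub_distrib, hRA.W_rowsum i]
    ring
  bernoulli t ht b H hH := by
    have h := hRA.bernoulli t ht (fun i => !b i) H (hist_one_sub_le t _ hH)
    have hset : {ω | ∀ i, 1 - a t ω i = if b i then (1 : ℝ) else 0} =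
        {ω | ∀ i, a t ω i = if !b i then (1 : ℝ) else 0} := by
      refine Set.ext fun ω => forall_congr' fun i => ?_
      cases b i
      · simp [sub_eq_zero, eq_comm (a := (1 : ℝ))]
      · simp
    have hfun : ∀ ω, (∏ i, if b i then 1 - x t ω i else 1 - (1 - x t ω i)) =
        ∏ i, if !b i then x t ω i else 1 - x t ω i := by
      refine fun ω => Finset.prod_congr rfl fun i _ => ?_
      cases b i <;> simp
    simp only [hset, hfun]
    exact h

theorem measurableSet_follows {b : ℕ → (Fin N → ℝ) → Fin N → Bool} (hb : ∀ s, Measurable (b s))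
    {t₀ : ℕ} (ht₀ : 1 ≤ t₀) {H : Set Ω} (hH : MeasurableSet[hist x a t₀] H) (n : ℕ) :
    MeasurableSet[hist x a (t₀ + n)] (follows x a b t₀ H n) := by
  induction n with
  | zero => simpa [follows] using hH
  | succ n ih =>
    rw [follows_succ]
    refine MeasurableSet.inter (hist_mono (by lia) _ ih) ?_
    have ha : Measurable[hist x a (t₀ + (n + 1))] (a (t₀ + n)) :=
      measurable_hist_a (by lia) (by lia)
    have hx : Measurable[hist x a (t₀ + (n + 1))] (x (t₀ + n)) :=
      measurable_hist_x (by lia) (by lia)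
    have hg : Measurable fun (β : Fin N → Bool) i => if β i then (1 : ℝ) else 0 :=
      measurable_of_countable _
    simp only [← funext_iff]
    exact measurableSet_eq_fun (m := hist x a (t₀ + (n + 1))) ha (hg.comp ((hb n).comp hx))

/-- If, while the policy is obeyed, the conditional probability of obeying it once more at step `n`
is at least `p n`, then it is obeyed during `n` steps with probability at least
`p 0 * ⋯ * p (n - 1)`. -/
theorem IsRAModel.prod_mul_le_measureReal_follows (hRA : IsRAModel μ α W x a)
    {b : ℕ → (Fin N → ℝ) → Fin N → Bool} (hb : ∀ s, Measurable (b s))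
    {t₀ : ℕ} (ht₀ : 1 ≤ t₀) {H : Set Ω} (hH : MeasurableSet[hist x a t₀] H)
    {p : ℕ → ℝ} (hp₀ : ∀ n, 0 ≤ p n)
    (hp : ∀ n, ∀ ω ∈ follows x a b t₀ H n, p n ≤
      ∏ i, if b n (x (t₀ + n) ω) i then x (t₀ + n) ω i else 1 - x (t₀ + n) ω i) (n : ℕ) :
    (∏ s ∈ Finset.range n, p s) * μ.real H ≤ μ.real (follows x a b t₀ H n) := by
  have := hRA.isProb
  induction n with
  | zero => simp [follows]
  | succ n ih =>
    have hBh : Measurable[hist x a (t₀ + n)] fun ω => b n (x (t₀ + n) ω) :=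
      (hb n).comp (measurable_hist_x (by lia) le_rfl)
    have hB : Measurable fun ω => b n (x (t₀ + n) ω) := (hb n).comp (hRA.x_meas _)
    have hF := measurableSet_follows hb ht₀ hH n
    rw [Finset.prod_range_succ, mul_right_comm]
    calc (∏ s ∈ Finset.range n, p s) * μ.real H * p n
        ≤ μ.real (follows x a b t₀ H n) * p n := mul_le_mul_of_nonneg_right ih (hp₀ n)
      _ = ∑ β, μ.real (follows x a b t₀ H n ∩ (fun ω => b n (x (t₀ + n) ω)) ⁻¹' {β}) * p n := by
          rw [← Finset.sum_mul, sum_measureReal_inter_preimage_singleton hB]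
      _ ≤ ∑ β, μ.real (follows x a b t₀ H (n + 1) ∩ (fun ω => b n (x (t₀ + n) ω)) ⁻¹' {β}) := by
          refine Finset.sum_le_sum fun β _ => ?_
          have hG : MeasurableSet[hist x a (t₀ + n)]
              (follows x a b t₀ H n ∩ (fun ω => b n (x (t₀ + n) ω)) ⁻¹' {β}) :=
            MeasurableSet.inter hF (hBh (measurableSet_singleton β))
          have hset : follows x a b t₀ H (n + 1) ∩ (fun ω => b n (x (t₀ + n) ω)) ⁻¹' {β} =
              (follows x a b t₀ H n ∩ (fun ω => b n (x (t₀ + n) ω)) ⁻¹' {β}) ∩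
                {ω | ∀ i, a (t₀ + n) ω i = if β i then (1 : ℝ) else 0} := by
            rw [follows_succ]
            ext ω
            simp only [Set.mem_inter_iff, Set.mem_ofPred_eq, Set.mem_preimage,
              Set.mem_singleton_iff]
            constructor
            · rintro ⟨⟨h1, h2⟩, rfl⟩
              exact ⟨⟨h1, rfl⟩, h2⟩
            · rintro ⟨⟨h1, rfl⟩, h2⟩
              exact ⟨⟨h1, h2⟩, rfl⟩
          rw [hset, ← smul_eq_mul, ← setIntegral_const]
          refine le_of_le_of_eq ?_ (hRA.bernoulli _ (by lia) β _ hG).symm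
          refine setIntegral_mono_on (integrable_const _).integrableOn ?_ (hRA.hist_le _ _ hG) ?_
          · refine (Integrable.of_bound (C := 1) ?_ (ae_of_all _ fun ω => ?_)).integrableOn
            · have := hRA.x_meas (t₀ + n)
              refine (Finset.measurable_prod _ fun i _ => ?_).aestronglyMeasurable
              split_ifs <;> fun_prop
            · have hx := hRA.x_mem (t₀ + n) (by lia) ω
              have h01 : ∀ i, 0 ≤ (if β i then x (t₀ + n) ω i else 1 - x (t₀ + n) ω i) ∧
                  (if β i then x (t₀ + n) ω i else 1 - x (t₀ + n) ω i) ≤ 1 := fun i => by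
                split_ifs
                · exact hx i
                · exact ⟨by linarith [(hx i).2], by linarith [(hx i).1]⟩
              rw [Real.norm_of_nonneg (Finset.prod_nonneg fun i _ => (h01 i).1)]
              exact Finset.prod_le_one (fun i _ => (h01 i).1) fun i _ => (h01 i).2
          · rintro ω ⟨h1, rfl⟩
            exact hp n ω h1
      _ = μ.real (follows x a b t₀ H (n + 1)) := sum_measureReal_inter_preimage_singleton hB _

end Model

section Reachability

variable {N : ℕ} {W : Matrix (Fin N) (Fin N) ℝ}

theorem pow_apply_nonneg (hW : ∀ i j, 0 ≤ W i j) (n : ℕ) (i j : Fin N) : 0 ≤ (W ^ n) i j := by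
  induction n generalizing i with
  | zero => rw [pow_zero, Matrix.one_apply]; split_ifs <;> norm_num
  | succ n ih =>
    rw [pow_succ', Matrix.mul_apply]
    exact Finset.sum_nonneg fun l _ => mul_nonneg (hW i l) (ih l)

theorem exists_pow_apply_pos_trans (hW : ∀ i j, 0 ≤ W i j) {i j l : Fin N}
    (hij : ∃ n, 0 < (W ^ n) i j) (hjl : ∃ n, 0 < (W ^ n) j l) : ∃ n, 0 < (W ^ n) i l := by
  obtain ⟨m, hm⟩ := hij
  obtain ⟨n, hn⟩ := hjl
  refine ⟨m + n, ?_⟩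
  rw [pow_add, Matrix.mul_apply]
  exact Finset.sum_pos' (fun _ _ => mul_nonneg (pow_apply_nonneg hW _ _ _)
    (pow_apply_nonneg hW _ _ _)) ⟨j, Finset.mem_univ j, mul_pos hm hn⟩

theorem exists_pow_apply_self_pos (W : Matrix (Fin N) (Fin N) ℝ) (i : Fin N) :
    ∃ n, 0 < (W ^ n) i i := ⟨0, by simp⟩

/-- Every agent is influenced by some agent whose communication class is maximal. -/
theorem exists_isMaximalClass_reachable (hW : ∀ i j, 0 ≤ W i j) (i : Fin N) :
    ∃ j, (∃ n, 0 < (W ^ n) i j) ∧ IsMaximalClass W {l | Communicates W j l} := by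
  classical
  let up : Fin N → Finset (Fin N) := fun j => Finset.univ.filter fun l => ∃ n, 0 < (W ^ n) j l
  obtain ⟨j, hj, hmin⟩ := Finset.exists_min_image (up i) (fun j => (up j).card)
    ⟨i, by simpa [up] using exists_pow_apply_self_pos W i⟩
  have hij : ∃ n, 0 < (W ^ n) i j := by simpa [up] using hj
  refine ⟨j, hij, ⟨j, rfl⟩, fun k hk l hkl => ?_⟩
  have hjl := exists_pow_apply_pos_trans hW hk.2 hkl
  have hsub : up l ⊆ up j := fun q hq => by
    simp only [up, Finset.mem_filter, Finset.mem_univ, true_and] at hq ⊢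
    exact exists_pow_apply_pos_trans hW hjl hq
  have heq : up l = up j := Finset.eq_of_subset_of_card_le hsub
    (hmin l (by simpa [up] using exists_pow_apply_pos_trans hW hij hjl))
  have hmem : j ∈ up l := heq ▸ by simpa [up] using exists_pow_apply_self_pos W j
  exact ⟨by simpa [up] using hmem, hjl⟩

/-- If the maximal class is unique, some agent influences all agents. -/
theorem exists_root (hN : 1 ≤ N) (hW : ∀ i j, 0 ≤ W i j)
    (huniq : ∃! C : Set (Fin N), IsMaximalClass W C) : ∃ k, ∀ i, ∃ n, 0 < (W ^ n) i k := by
  obtain ⟨k, -, hk⟩ := exists_isMaximalClass_reachable hW ⟨0, hN⟩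
  refine ⟨k, fun i => ?_⟩
  obtain ⟨j, hij, hj⟩ := exists_isMaximalClass_reachable hW i
  have hmem : k ∈ {l | Communicates W j l} :=
    huniq.unique hk hj ▸ ⟨exists_pow_apply_self_pos W k, exists_pow_apply_self_pos W k⟩
  exact exists_pow_apply_pos_trans hW hij hmem.2

theorem exists_spread_rate {α : ℝ} (hα : α ∈ Set.Ioo (0 : ℝ) 1) (W : Matrix (Fin N) (Fin N) ℝ) :
    ∃ ρ, 0 < ρ ∧ ρ ≤ 1 - α ∧ ∀ i j, 0 < W i j → ρ ≤ α * W i j := by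
  have h : ∀ᶠ ρ in nhdsWithin (0 : ℝ) (Set.Ioi 0),
      0 < ρ ∧ ρ ≤ 1 - α ∧ ∀ i j, 0 < W i j → ρ ≤ α * W i j := by
    refine (eventually_mem_nhdsWithin).and (Eventually.and ?_ (eventually_all.2 fun i =>
      eventually_all.2 fun j => eventually_imp_distrib_left.2 fun hij => ?_))
    · filter_upwards [Ioc_mem_nhdsGT (sub_pos.2 hα.2)] with ρ hρ using hρ.2
    · filter_upwards [Ioc_mem_nhdsGT (mul_pos hα.1 hij)] with ρ hρ using hρ.2
  exact h.exists

end Reachability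

section Growth

/-- Until time `T`, the action `1` is played exactly by the agents above a geometrically decreasing
threshold; from time `T` on it is played by everyone. -/
noncomputable def growthPolicy {N : ℕ} (ρ : ℝ) (T s : ℕ) (v : Fin N → ℝ) (i : Fin N) : Bool :=
  decide (T ≤ s ∨ ρ ^ s / 2 ≤ v i)

theorem measurable_growthPolicy {N : ℕ} (ρ : ℝ) (T s : ℕ) :
    Measurable (growthPolicy (N := N) ρ T s) := by
  refine measurable_pi_lambda _ fun i => measurable_to_bool ?_
  have h : (fun v : Fin N → ℝ => growthPolicy ρ T s v i) ⁻¹' {true} =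
      {_v | T ≤ s} ∪ {v | ρ ^ s / 2 ≤ v i} := by
    ext v
    simp [growthPolicy]
  rw [h]
  exact (MeasurableSet.const _).union (measurableSet_le measurable_const (measurable_pi_apply i))

variable {N : ℕ} [MeasurableSpace Ω] {μ : Measure Ω} {α : ℝ} {W : Matrix (Fin N) (Fin N) ℝ}
  {x a : ℕ → Ω → Fin N → ℝ} {ρ : ℝ} {T t₀ n : ℕ} {H : Set Ω} {ω : Ω}

theorem IsRAModel.mul_action_nonneg (hRA : IsRAModel μ α W x a) {t : ℕ} (ht : 1 ≤ t) (i j : Fin N) :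
    0 ≤ W i j * a t ω j :=
  mul_nonneg (hRA.W_nonneg i j) (by rcases hRA.a_mem t ht ω j with h | h <;> simp [h])

theorem IsRAModel.pow_div_two_le_of_mem_follows (hRA : IsRAModel μ α W x a) (hρ : 0 < ρ)
    (hρα : ρ ≤ 1 - α) (hρW : ∀ i j, 0 < W i j → ρ ≤ α * W i j) {k : Fin N} (ht₀ : 1 ≤ t₀)
    (hH : ∀ ω ∈ H, 1 / 2 ≤ x t₀ ω k) (hω : ω ∈ follows x a (growthPolicy ρ T) t₀ H n) {s : ℕ}
    (hs : s ≤ n) {m : ℕ} (hm : m ≤ s) {i : Fin N} (hi : 0 < (W ^ m) i k) :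
    ρ ^ s / 2 ≤ x (t₀ + s) ω i := by
  have hα := hRA.alpha_mem
  induction s generalizing m i with
  | zero =>
    obtain rfl : m = 0 := by lia
    rw [pow_zero, Matrix.one_apply] at hi
    split_ifs at hi with h
    · subst h
      simpa using hH ω hω.1
    · exact absurd hi (lt_irrefl 0)
  | succ s ih =>
    have ht : 1 ≤ t₀ + s := by lia
    have hρs : 0 < ρ ^ s := pow_pos hρ s
    rw [← add_assoc, hRA.update _ ht, pow_succ]
    have hxi := (hRA.x_mem _ ht ω i).1
    rcases hm.lt_or_eq with hm | rfl
    · have h1 := ih (by lia) (by lia : m ≤ s) hi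
      have h2 : 0 ≤ ∑ j, W i j * a (t₀ + s) ω j :=
        Finset.sum_nonneg fun j _ => hRA.mul_action_nonneg ht i j
      have h3 : ρ * (ρ ^ s / 2) ≤ (1 - α) * x (t₀ + s) ω i :=
        mul_le_mul hρα h1 (by positivity) (by linarith [hα.2])
      nlinarith [mul_nonneg hα.1.le h2]
    · rw [pow_succ', Matrix.mul_apply] at hi
      obtain ⟨j, -, hj⟩ := Finset.exists_lt_of_sum_lt
        (s := Finset.univ) (f := fun _ : Fin N => (0 : ℝ)) (by simpa using hi)
      have hWij : 0 < W i j := (hRA.W_nonneg i j).lt_of_ne fun h => by simp [← h] at hj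
      have hjs := ih (by lia) le_rfl (pos_of_mul_pos_right hj hWij.le)
      have haj : a (t₀ + s) ω j = 1 := by
        rw [hω.2 s (by lia) j]
        simp [growthPolicy, hjs]
      have h2 : W i j ≤ ∑ j, W i j * a (t₀ + s) ω j := by
        have := Finset.single_le_sum (f := fun j => W i j * a (t₀ + s) ω j)
          (fun j _ => hRA.mul_action_nonneg ht i j) (Finset.mem_univ j)
        simpa [haj] using this
      have h3 : ρ ^ s ≤ 1 := pow_le_one₀ hρ.le (by linarith [hα.1])
      have h4 := mul_le_mul_of_nonneg_left h2 hα.1.le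
      have h5 := hρW i j hWij
      have h6 : 0 ≤ (1 - α) * x (t₀ + s) ω i := mul_nonneg (by linarith [hα.2]) hxi
      nlinarith

theorem IsRAModel.one_sub_le_of_mem_follows (hRA : IsRAModel μ α W x a) (ht₀ : 1 ≤ t₀) {κ : ℝ}
    (hω : ω ∈ follows x a (growthPolicy ρ T) t₀ H n) (hκ : ∀ i, κ ≤ x (t₀ + T) ω i) {s : ℕ}
    (hs : T + s ≤ n) (i : Fin N) : 1 - x (t₀ + (T + s)) ω i ≤ (1 - α) ^ s * (1 - κ) := by
  induction s with
  | zero =>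
    have := hκ i
    simp only [add_zero, pow_zero, one_mul]
    linarith
  | succ s ih =>
    have ha : ∀ j, a (t₀ + (T + s)) ω j = 1 := fun j => by
      rw [hω.2 (T + s) (by lia) j]
      simp [growthPolicy]
    have hu := hRA.update (t₀ + (T + s)) (by lia) ω i
    simp only [ha, mul_one, hRA.W_rowsum i] at hu
    have h := mul_le_mul_of_nonneg_left (ih (by lia)) (sub_nonneg.2 hRA.alpha_mem.2.le)
    have hidx : t₀ + (T + (s + 1)) = t₀ + (T + s) + 1 := by ring
    rw [hidx, hu, pow_succ]
    linarith

theorem exp_neg_div_le_one_sub {u κ : ℝ} (hκ : 0 < κ) (hu : 0 ≤ u) (huκ : u ≤ 1 - κ) :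
    Real.exp (-(u / κ)) ≤ 1 - u := by
  have h1 : 0 < 1 - u := by linarith
  rw [← Real.le_log_iff_exp_le h1]
  refine le_trans ?_ (Real.one_sub_inv_le_log_of_pos h1)
  have h2 : 1 - (1 - u)⁻¹ = -(u / (1 - u)) := by
    field_simp
    ring
  rw [h2]
  gcongr
  linarith

/-- A lower bound for the probability of obeying the growth policy at step `s`. -/
noncomputable def growthBound (N : ℕ) (α κ : ℝ) (T s : ℕ) : ℝ :=
  if s < T then κ ^ N else Real.exp (-((1 - α) ^ (s - T) / κ)) ^ N

theorem exists_pos_le_prod_growthBound (N : ℕ) (hα : α ∈ Set.Ioo (0 : ℝ) 1) {κ : ℝ} (hκ : 0 < κ)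
    (hκ1 : κ ≤ 1) (T : ℕ) :
    ∃ c > 0, ∀ n, c ≤ ∏ s ∈ Finset.range n, growthBound N α κ T s := by
  have hr : 0 ≤ 1 - α := by linarith [hα.2]
  have hpos : ∀ s, 0 < growthBound N α κ T s := fun s => by
    rw [growthBound]
    split_ifs <;> positivity
  have hle : ∀ s, growthBound N α κ T s ≤ 1 := fun s => by
    rw [growthBound]
    split_ifs
    · exact pow_le_one₀ hκ.le hκ1
    · refine pow_le_one₀ (Real.exp_nonneg _) (Real.exp_le_one_iff.2 (neg_nonpos.2 ?_))
      positivity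
  refine ⟨(∏ s ∈ Finset.range T, growthBound N α κ T s) * Real.exp (-(α⁻¹ / κ)) ^ N,
    mul_pos (Finset.prod_pos fun s _ => hpos s) (by positivity), fun n => ?_⟩
  calc _ ≤ ∏ s ∈ Finset.range (T + n), growthBound N α κ T s := by
        rw [Finset.prod_range_add]
        refine mul_le_mul_of_nonneg_left ?_ (Finset.prod_nonneg fun s _ => (hpos s).le)
        simp only [growthBound, add_tsub_cancel_left, not_lt.2 (Nat.le_add_right T _), if_false]
        rw [Finset.prod_pow, ← Real.exp_sum, Finset.sum_neg_distrib, ← Finset.sum_div]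
        have hsum : ∑ s ∈ Finset.range n, (1 - α) ^ s ≤ α⁻¹ := by
          have hlt : 1 - α < 1 := by linarith [hα.1]
          have h := (summable_geometric_of_lt_one hr hlt).sum_le_tsum (Finset.range n)
            fun s _ => pow_nonneg hr s
          rwa [tsum_geometric_of_lt_one hr hlt, sub_sub_cancel] at h
        gcongr
    _ ≤ _ := Finset.prod_le_prod_of_subset_of_le_one
        (Finset.range_mono (by lia)) (fun s _ => (hpos s).le) fun s _ _ => hle s

/-- If `k` influences everyone, then given that `k` is at least `1 / 2`, all agents converge to `1`
with probability bounded below. -/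
theorem IsRAModel.exists_le_measureReal_tendsto_one (hRA : IsRAModel μ α W x a) {k : Fin N}
    (hk : ∀ i, ∃ n, 0 < (W ^ n) i k) :
    ∃ c > 0, ∀ t₀ ≥ 1, ∀ H, MeasurableSet[hist x a t₀] H → (∀ ω ∈ H, 1 / 2 ≤ x t₀ ω k) →
      c * μ.real H ≤ μ.real (H ∩ {ω | ∀ i, Tendsto (fun t => x t ω i) atTop (nhds 1)}) := by
  have := hRA.isProb
  have hα := hRA.alpha_mem
  obtain ⟨ρ, hρ, hρα, hρW⟩ := exists_spread_rate hα W
  choose d hd using hk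
  set T := Finset.univ.sup d
  have hdT : ∀ i, d i ≤ T := fun i => Finset.le_sup (Finset.mem_univ i)
  set κ := ρ ^ T / 2 with hκdef
  have hρ1 : ρ ≤ 1 := by linarith [hα.1]
  have hκ : 0 < κ := by positivity
  have hκ2 : κ ≤ 1 / 2 := by linarith [pow_le_one₀ hρ.le hρ1 (n := T)]
  obtain ⟨c, hc, hcprod⟩ := exists_pos_le_prod_growthBound N hα hκ (by linarith) T
  refine ⟨c, hc, fun t₀ ht₀ H hH hHk => ?_⟩
  have hκx : ∀ n ≥ T, ∀ ω ∈ follows x a (growthPolicy ρ T) t₀ H n, ∀ i, κ ≤ x (t₀ + T) ω i :=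
    fun n hn ω hω i =>
      hRA.pow_div_two_le_of_mem_follows hρ hρα hρW ht₀ hHk hω hn (hdT i) (hd i)
  have hstep : ∀ n, ∀ ω ∈ follows x a (growthPolicy ρ T) t₀ H n, growthBound N α κ T n ≤
      ∏ i, if growthPolicy ρ T n (x (t₀ + n) ω) i then x (t₀ + n) ω i
        else 1 - x (t₀ + n) ω i := by
    intro n ω hω
    have hconst : ∀ q : ℝ, q ^ N = ∏ _i : Fin N, q := by simp
    rw [growthBound]
    split_ifs with hn
    · rw [hconst]
      refine Finset.prod_le_prod (fun _ _ => hκ.le) fun i _ => ?_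
      split_ifs with hb
      · have hb' : ρ ^ n / 2 ≤ x (t₀ + n) ω i := by
          simpa [growthPolicy, not_le.2 hn] using hb
        have : ρ ^ T ≤ ρ ^ n := pow_le_pow_of_le_one hρ.le hρ1 hn.le
        linarith
      · have hb' : x (t₀ + n) ω i < ρ ^ n / 2 := by
          simpa [growthPolicy, not_le.2 hn] using hb
        linarith [pow_le_one₀ hρ.le hρ1 (n := n)]
    · obtain ⟨s, rfl⟩ := Nat.exists_eq_add_of_le (not_lt.1 hn)
      rw [add_tsub_cancel_left, hconst]
      refine Finset.prod_le_prod (fun _ _ => Real.exp_nonneg _) fun i _ => ?_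
      rw [if_pos (by simp [growthPolicy])]
      have h1 := hRA.one_sub_le_of_mem_follows ht₀ hω (hκx _ (by lia) ω hω) le_rfl i
      have hr : 0 ≤ 1 - α := by linarith [hα.2]
      have hrs : 0 ≤ (1 - α) ^ s := pow_nonneg hr s
      have hrs1 : (1 - α) ^ s ≤ 1 := pow_le_one₀ hr (by linarith [hα.1])
      have h2 := exp_neg_div_le_one_sub hκ (u := (1 - α) ^ s * (1 - κ))
        (mul_nonneg hrs (by linarith)) (mul_le_of_le_one_left (by linarith) hrs1)
      have h3 : Real.exp (-((1 - α) ^ s / κ)) ≤ Real.exp (-((1 - α) ^ s * (1 - κ) / κ)) := by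
        gcongr
        exact mul_le_of_le_one_right hrs (by linarith)
      linarith
  have hbound : ∀ n, c * μ.real H ≤ μ.real (follows x a (growthPolicy ρ T) t₀ H n) := fun n =>
    (mul_le_mul_of_nonneg_right (hcprod n) measureReal_nonneg).trans
      (hRA.prod_mul_le_measureReal_follows (measurable_growthPolicy ρ T) ht₀ hH
        (fun n => by rw [growthBound]; split_ifs <;> positivity) hstep n)
  have hanti : Antitone (follows x a (growthPolicy ρ T) t₀ H) := fun m n hmn ω hω =>
    ⟨hω.1, fun s hs => hω.2 s (hs.trans_le hmn)⟩
  have hlim : Tendsto (fun n => μ.real (follows x a (growthPolicy ρ T) t₀ H n)) atTop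
      (nhds (μ.real (⋂ n, follows x a (growthPolicy ρ T) t₀ H n))) :=
    (ENNReal.tendsto_toReal (measure_ne_top _ _)).comp (tendsto_measure_iInter_atTop
      (fun n => (hRA.hist_le _ _ (measurableSet_follows (measurable_growthPolicy ρ T) ht₀ hH
        n)).nullMeasurableSet) hanti ⟨0, measure_ne_top _ _⟩)
  refine (ge_of_tendsto' hlim hbound).trans (measureReal_mono fun ω hω => ?_)
  rw [Set.mem_iInter] at hω
  refine ⟨(hω 0).1, fun i => ?_⟩
  rw [← tendsto_add_atTop_iff_nat (t₀ + T)]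
  refine tendsto_of_tendsto_of_tendsto_of_le_of_le (g := fun s => 1 - (1 - α) ^ s * (1 - κ))
    (h := fun _ => 1) ?_ tendsto_const_nhds (fun s => ?_) fun s => ?_
  · have h := (tendsto_pow_atTop_nhds_zero_of_lt_one (r := 1 - α) (by linarith [hα.2])
      (by linarith [hα.1])).mul_const (1 - κ)
    simpa using h.const_sub 1
  · have h := hRA.one_sub_le_of_mem_follows ht₀ (hω (T + s)) (hκx _ (by lia) ω (hω (T + s)))
      le_rfl i
    have hidx : s + (t₀ + T) = t₀ + (T + s) := by ring
    simp only [hidx]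
    linarith
  · exact (hRA.x_mem _ (by lia) ω i).2

theorem measurableSet_forall_tendsto (q : ℝ) :
    MeasurableSet[⨆ n, hist x a (n + 1)]
      {ω | ∀ i, Tendsto (fun t => x t ω i) atTop (nhds q)} := by
  have h : {ω | ∀ i, Tendsto (fun t => x t ω i) atTop (nhds q)} =
      ⋂ i, {ω | Tendsto (fun t => x (t + 1) ω i) atTop (nhds q)} := by
    ext ω
    simp only [Set.mem_ofPred_eq, Set.mem_iInter]
    exact forall_congr' fun i =>
      (tendsto_add_atTop_iff_nat (f := fun t => x t ω i) 1).symm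
  rw [h]
  refine MeasurableSet.iInter fun i => measurableSet_tendsto _ fun t => ?_
  exact (measurable_pi_apply i).comp ((measurable_hist_x (by lia) le_rfl).mono
    (le_iSup (fun n => hist x a (n + 1)) t) le_rfl)

end Growth

theorem unique_maximal_class_consensus {Ω : Type*} [MeasurableSpace Ω] {N : ℕ} (hN : 1 ≤ N)
    (μ : Measure Ω) (α : ℝ) (W : Matrix (Fin N) (Fin N) ℝ)
    (x a : ℕ → Ω → Fin N → ℝ) (hRA : IsRAModel μ α W x a)
    (huniq : ∃! C : Set (Fin N), IsMaximalClass W C) :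
    ∀ᵐ ω ∂μ,
      (∀ i, Filter.Tendsto (fun t => x t ω i) Filter.atTop (nhds 0))
      ∨ (∀ i, Filter.Tendsto (fun t => x t ω i) Filter.atTop (nhds 1)) := by
  have := hRA.isProb
  obtain ⟨k, hk⟩ := exists_root hN hRA.W_nonneg huniq
  obtain ⟨c₁, hc₁, h₁⟩ := hRA.exists_le_measureReal_tendsto_one hk
  obtain ⟨c₀, hc₀, h₀⟩ := hRA.one_sub.exists_le_measureReal_tendsto_one hk
  have hflip : {ω | ∀ i, Tendsto (fun t => 1 - x t ω i) atTop (nhds 1)} =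
      {ω | ∀ i, Tendsto (fun t => x t ω i) atTop (nhds 0)} :=
    Set.ext fun ω => forall_congr' fun i =>
      ⟨fun h => by simpa using h.const_sub 1, fun h => by simpa using h.const_sub 1⟩
  rw [hflip] at h₀
  set E₀ := {ω | ∀ i, Tendsto (fun t => x t ω i) atTop (nhds 0)}
  set E₁ := {ω | ∀ i, Tendsto (fun t => x t ω i) atTop (nhds 1)}
  let ℱ : Filtration ℕ ‹MeasurableSpace Ω› :=
    ⟨fun n => hist x a (n + 1), fun _ _ h => hist_mono (by lia), fun n => hRA.hist_le _⟩
  have hE : MeasurableSet[⨆ n, ℱ n] (E₀ ∪ E₁) :=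
    (measurableSet_forall_tendsto 0).union (measurableSet_forall_tendsto 1)
  suffices h : ∀ᵐ ω ∂μ, ω ∈ E₀ ∪ E₁ by
    filter_upwards [h] with ω hω using hω
  refine ae_mem_of_forall_le_measureReal_inter ℱ hE (lt_min hc₀ hc₁) fun n H hH => ?_
  set A := {ω | 1 / 2 ≤ x (n + 1) ω k}
  have hA : MeasurableSet[hist x a (n + 1)] A := by
    have hx : Measurable[hist x a (n + 1)] fun ω => x (n + 1) ω k :=
      (measurable_pi_apply k).comp (measurable_hist_x (by lia) le_rfl)
    exact hx measurableSet_Ici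
  have hA' : MeasurableSet A := hRA.hist_le _ _ hA
  have hup := h₁ (n + 1) (by lia) (H ∩ A) (MeasurableSet.inter hH hA) fun ω hω => hω.2
  have hdown := h₀ (n + 1) (by lia) (H \ A) (le_hist_one_sub _ _ (MeasurableSet.diff hH hA))
    fun ω hω => by
      have : x (n + 1) ω k < 1 / 2 := not_le.1 hω.2
      linarith
  calc min c₀ c₁ * μ.real H
      = min c₀ c₁ * μ.real (H ∩ A) + min c₀ c₁ * μ.real (H \ A) := by
        rw [← mul_add, measureReal_inter_add_sdiff hA']
    _ ≤ c₁ * μ.real (H ∩ A) + c₀ * μ.real (H \ A) := by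
        gcongr
        · exact min_le_right _ _
        · exact min_le_left _ _
    _ ≤ μ.real (H ∩ A ∩ E₁) + μ.real ((H \ A) ∩ E₀) := add_le_add hup hdown
    _ ≤ μ.real (H ∩ (E₀ ∪ E₁) ∩ A) + μ.real ((H ∩ (E₀ ∪ E₁)) \ A) := by
        refine add_le_add (measureReal_mono fun ω hω => ?_) (measureReal_mono fun ω hω => ?_)
        · exact ⟨⟨hω.1.1, Or.inr hω.2⟩, hω.1.2⟩
        · exact ⟨⟨hω.1.1, Or.inl hω.2⟩, hω.1.2⟩
    _ = μ.real (H ∩ (E₀ ∪ E₁)) := measureReal_inter_add_sdiff hA'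

end RA
end

section
/- Under the RA model with W irreducible: the process q_t = π^T x_t is a martingale with respect to the filtration F_t = σ(x_1, a_1, …, a_{t−1}); that is, E[q_{t+1} | F_t] = q_t almost surely for every t ≥ 1. Moreover 0 ≤ q_t ≤ 1 for all t (in particular E[q_t] ≤ 1). -/
open MeasureTheory ProbabilityTheory Filter

namespace RA

variable {Ω : Type*}

/-- The `i`-th marginal of a product of Bernoulli laws with success probabilities `p`. -/
lemma sum_mul_prod_bernoulli {N : ℕ} (p : Fin N → ℝ) (i : Fin N) :
    ∑ b : Fin N → Bool, (if b i then (1 : ℝ) else 0) * ∏ j, (if b j then p j else 1 - p j)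
      = p i := by
  have h := Fintype.prod_sum (fun (j : Fin N) (c : Bool) =>
    (if j = i then (if c then (1 : ℝ) else 0) else 1) * (if c then p j else 1 - p j))
  simp only [Finset.prod_mul_distrib, Finset.prod_ite_eq', Finset.mem_univ, if_true] at h
  rw [← h, Finset.prod_eq_single i (fun j _ hj => by simp [hj]) (by simp)]
  simp

/-- A coordinate of a `0`-`1` vector, expanded over all `0`-`1` patterns. -/
lemma eq_sum_indicator_pattern {N : ℕ} (f : Ω → Fin N → ℝ) (hf : ∀ ω i, f ω i = 0 ∨ f ω i = 1)
    (i : Fin N) (ω : Ω) :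
    f ω i = ∑ b : Fin N → Bool, (if b i then (1 : ℝ) else 0) *
      {ω | ∀ j, f ω j = if b j then (1 : ℝ) else 0}.indicator (fun _ => (1 : ℝ)) ω := by
  classical
  have hpat : ∀ j, f ω j = if decide (f ω j = 1) then (1 : ℝ) else 0 := fun j => by
    rcases hf ω j with h | h <;> simp [h]
  rw [Finset.sum_eq_single (fun j => decide (f ω j = 1))]
  · rw [Set.indicator_of_mem (by exact hpat), mul_one]
    exact hpat i
  · intro b _ hb
    rw [Set.indicator_of_notMem, mul_zero]
    intro hmem
    apply hb
    ext j
    rw [hmem j]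
    cases b j <;> simp
  · simp

namespace IsRAModel

variable [MeasurableSpace Ω] {N : ℕ} {μ : Measure Ω} {α : ℝ} {W : Matrix (Fin N) (Fin N) ℝ}
  {x a : ℕ → Ω → Fin N → ℝ}

lemma hist_le_s10 (h : IsRAModel μ α W x a) (t : ℕ) : hist x a t ≤ ‹MeasurableSpace Ω› :=
  sup_le (iSup₂_le fun s _ => (h.x_meas s).comap_le) (iSup₂_le fun s _ => (h.a_meas s).comap_le)

lemma measurable_hist {t : ℕ} (ht : 1 ≤ t) : Measurable[hist x a t] (x t) :=
  Measurable.of_comap_le <| le_sup_of_le_left <|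
    le_iSup₂_of_le (f := fun s (_ : s ∈ Finset.Icc 1 t) => MeasurableSpace.comap (x s) inferInstance)
      t (Finset.mem_Icc.2 ⟨ht, le_rfl⟩) le_rfl

lemma measurable_x (h : IsRAModel μ α W x a) (t : ℕ) (i : Fin N) :
    Measurable fun ω => x t ω i := (measurable_pi_apply i).comp (h.x_meas t)

lemma measurable_a (h : IsRAModel μ α W x a) (t : ℕ) (i : Fin N) :
    Measurable fun ω => a t ω i := (measurable_pi_apply i).comp (h.a_meas t)

lemma integrable_x (h : IsRAModel μ α W x a) {t : ℕ} (ht : 1 ≤ t) (i : Fin N) :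
    Integrable (fun ω => x t ω i) μ :=
  have := h.isProb
  Integrable.of_mem_Icc 0 1 (h.measurable_x t i).aemeasurable
    (ae_of_all _ fun ω => h.x_mem t ht ω i)

lemma integrable_a (h : IsRAModel μ α W x a) {t : ℕ} (ht : 1 ≤ t) (i : Fin N) :
    Integrable (fun ω => a t ω i) μ :=
  have := h.isProb
  Integrable.of_mem_Icc 0 1 (h.measurable_a t i).aemeasurable
    (ae_of_all _ fun ω => by rcases h.a_mem t ht ω i with h | h <;> simp [h])

lemma integrable_prod (h : IsRAModel μ α W x a) {t : ℕ} (ht : 1 ≤ t) (b : Fin N → Bool) :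
    Integrable (fun ω => ∏ i, (if b i then x t ω i else 1 - x t ω i)) μ := by
  have := h.isProb
  have hmem : ∀ ω i, (if b i then x t ω i else 1 - x t ω i) ∈ Set.Icc (0 : ℝ) 1 := fun ω i => by
    have := h.x_mem t ht ω i
    split_ifs
    · exact this
    · exact ⟨by linarith [this.2], by linarith [this.1]⟩
  refine Integrable.of_mem_Icc 0 1 (Measurable.aemeasurable ?_) (ae_of_all _ fun ω =>
    ⟨Finset.prod_nonneg fun i _ => (hmem ω i).1,
      Finset.prod_le_one (fun i _ => (hmem ω i).1) fun i _ => (hmem ω i).2⟩)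
  refine Finset.measurable_fun_prod _ fun i _ => ?_
  split_ifs
  · exact h.measurable_x t i
  · exact (h.measurable_x t i).const_sub 1

/-- Given the history, an action has conditional mean equal to the current opinion. -/
lemma setIntegral_action (h : IsRAModel μ α W x a) {t : ℕ} (ht : 1 ≤ t) (i : Fin N) {H : Set Ω}
    (hH : MeasurableSet[hist x a t] H) :
    ∫ ω in H, a t ω i ∂μ = ∫ ω in H, x t ω i ∂μ := by
  have := h.isProb
  have hA : ∀ b : Fin N → Bool,
      MeasurableSet {ω | ∀ j, a t ω j = if b j then (1 : ℝ) else 0} := fun b => by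
    rw [Set.ofPred_forall]
    exact MeasurableSet.iInter fun j => h.measurable_a t j (measurableSet_singleton _)
  calc ∫ ω in H, a t ω i ∂μ
      = ∫ ω in H, ∑ b : Fin N → Bool, (if b i then (1 : ℝ) else 0) *
          {ω | ∀ j, a t ω j = if b j then (1 : ℝ) else 0}.indicator
            (fun _ => (1 : ℝ)) ω ∂μ := by
        simp_rw [← eq_sum_indicator_pattern (a t) (h.a_mem t ht) i]
    _ = ∑ b : Fin N → Bool, (if b i then (1 : ℝ) else 0) *
          ∫ ω in H, ∏ j, (if b j then x t ω j else 1 - x t ω j) ∂μ := by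
        rw [integral_finsetSum _ fun b _ =>
          (((integrable_const (1 : ℝ)).indicator (hA b)).const_mul _)]
        refine Finset.sum_congr rfl fun b _ => ?_
        rw [integral_const_mul, ← h.bernoulli t ht b H hH, setIntegral_indicator (hA b),
          setIntegral_const, smul_eq_mul, mul_one, Measure.real]
    _ = ∫ ω in H, x t ω i ∂μ := by
        simp_rw [← integral_const_mul]
        rw [← integral_finsetSum _ fun b _ => ((h.integrable_prod ht b).integrableOn.const_mul _)]
        simp_rw [sum_mul_prod_bernoulli]

/-- The one-step evolution of a weighted average with left-invariant weights. -/
lemma weighted_update (h : IsRAModel μ α W x a) {π : Fin N → ℝ}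
    (hπW : ∀ j, ∑ i, π i * W i j = π j) {t : ℕ} (ht : 1 ≤ t) (ω : Ω) :
    ∑ i, π i * x (t + 1) ω i
      = (1 - α) * ∑ i, π i * x t ω i + α * ∑ i, π i * a t ω i := by
  have hW : ∑ i, π i * ∑ j, W i j * a t ω j = ∑ j, π j * a t ω j := by
    simp_rw [Finset.mul_sum, ← mul_assoc]
    rw [Finset.sum_comm]
    simp_rw [← Finset.sum_mul, hπW]
  rw [← hW, Finset.mul_sum, Finset.mul_sum, ← Finset.sum_add_distrib]
  refine Finset.sum_congr rfl fun i _ => ?_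
  rw [h.update t ht ω i]
  ring

lemma weighted_mem_Icc (h : IsRAModel μ α W x a) {π : Fin N → ℝ} (hπ : ∀ i, 0 ≤ π i)
    (hπsum : ∑ i, π i = 1) {t : ℕ} (ht : 1 ≤ t) (ω : Ω) :
    ∑ i, π i * x t ω i ∈ Set.Icc (0 : ℝ) 1 :=
  (convex_Icc (0 : ℝ) 1).sum_mem (fun i _ => hπ i) hπsum fun i _ => h.x_mem t ht ω i

lemma integrable_weighted (h : IsRAModel μ α W x a) (π : Fin N → ℝ) {t : ℕ} (ht : 1 ≤ t) :
    Integrable (fun ω => ∑ i, π i * x t ω i) μ :=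
  integrable_finsetSum _ fun i _ => (h.integrable_x ht i).const_mul _

lemma condExp_weighted (h : IsRAModel μ α W x a) {π : Fin N → ℝ}
    (hπW : ∀ j, ∑ i, π i * W i j = π j) {t : ℕ} (ht : 1 ≤ t) :
    μ[fun ω => ∑ i, π i * x (t + 1) ω i | hist x a t] =ᵐ[μ] fun ω => ∑ i, π i * x t ω i := by
  have := h.isProb
  have hq := h.integrable_weighted π ht
  have ha : Integrable (fun ω => ∑ i, π i * a t ω i) μ :=
    integrable_finsetSum _ fun i _ => (h.integrable_a ht i).const_mul _
  refine (ae_eq_condExp_of_forall_setIntegral_eq (h.hist_le_s10 t)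
    (h.integrable_weighted π (by omega)) (fun _ _ _ => hq.integrableOn) (fun H hH _ => ?_) ?_).symm
  · have hswap : ∫ ω in H, ∑ i, π i * a t ω i ∂μ = ∫ ω in H, ∑ i, π i * x t ω i ∂μ := by
      rw [integral_finsetSum _ fun i _ => (h.integrable_a ht i).integrableOn.const_mul _,
        integral_finsetSum _ fun i _ => (h.integrable_x ht i).integrableOn.const_mul _]
      simp_rw [integral_const_mul, h.setIntegral_action ht _ hH]
    simp_rw [h.weighted_update hπW ht]
    rw [integral_add (hq.integrableOn.const_mul _) (ha.integrableOn.const_mul _),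
      integral_const_mul, integral_const_mul, hswap]
    ring
  · refine (Measurable.stronglyMeasurable ?_).aestronglyMeasurable
    exact Finset.measurable_fun_sum _ fun i _ =>
      ((measurable_pi_apply i).comp (measurable_hist ht)).const_mul _

end IsRAModel

theorem q_is_bounded_martingale {Ω : Type*} [MeasurableSpace Ω] {N : ℕ} (hN : 1 ≤ N)
    (μ : Measure Ω) (α : ℝ) (W : Matrix (Fin N) (Fin N) ℝ)
    (x a : ℕ → Ω → Fin N → ℝ) (hRA : IsRAModel μ α W x a)
    (hirr : Irreducible W) (π : Fin N → ℝ) (hπpos : ∀ i, 0 < π i)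
    (hπsum : ∑ i, π i = 1) (hπW : ∀ j, ∑ i, π i * W i j = π j) :
    (∀ t : ℕ, 1 ≤ t →
      μ[fun ω => ∑ i, π i * x (t + 1) ω i | hist x a t]
        =ᵐ[μ] fun ω => ∑ i, π i * x t ω i)
    ∧ (∀ t : ℕ, 1 ≤ t → ∀ ω, (∑ i, π i * x t ω i) ∈ Set.Icc (0 : ℝ) 1)
    ∧ (∀ t : ℕ, 1 ≤ t → ∫ ω, (∑ i, π i * x t ω i) ∂μ ≤ 1) := by
  have := hRA.isProb
  have hmem := fun t (ht : 1 ≤ t) => hRA.weighted_mem_Icc (fun i => (hπpos i).le) hπsum ht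
  refine ⟨fun t ht => hRA.condExp_weighted hπW ht, hmem, fun t ht => ?_⟩
  calc ∫ ω, (∑ i, π i * x t ω i) ∂μ ≤ ∫ _, (1 : ℝ) ∂μ :=
        integral_mono (hRA.integrable_weighted π ht) (integrable_const _) fun ω => (hmem t ht ω).2
    _ = 1 := by simp

end RA
end
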